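/- Let m ≥ 2 and let G be the simple graph on vertex set {0, 1, …, 2m} in which, for each 0 ≤ i < 2m, vertex i is adjacent to vertex (i+1) mod 2m (forming a cycle of length 2m), and additionally vertex 2m is adjacent exactly to vertex 0 (a pendant vertex). Then every vertex cover of G has at least m vertices, and the unique vertex cover of G with exactly m vertices is {0, 2, 4, …, 2m−2}, the set of cycle vertices at even distance from the attachment vertex 0. -/

import Mathlib

/-- The graph on vertex set `{0, 1, …, 2m}` consisting of a cycle `0, 1, …, 2m-1`
(vertex `i` adjacent to `(i+1) % (2m)` for `i < 2m`) together with a pendant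
vertex `2m` adjacent exactly to the cycle vertex `0`. -/
def cycleWithPendant (m : ℕ) : SimpleGraph ℕ :=
  SimpleGraph.fromRel
    (fun i j => (i < 2 * m ∧ j = (i + 1) % (2 * m)) ∨ (i = 2 * m ∧ j = 0))

/-- A vertex cover of `cycleWithPendant m`: a subset of the vertex set
`{0, 1, …, 2m}` meeting every edge. -/
def IsCycleWithPendantCover (m : ℕ) (S : Finset ℕ) : Prop :=
  S ⊆ Finset.range (2 * m + 1) ∧
    ∀ i j, (cycleWithPendant m).Adj i j → i ∈ S ∨ j ∈ S

theorem cwp_edge (m : ℕ) (hm : 2 ≤ m) (S : Finset ℕ) (h : IsCycleWithPendantCover m S)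
    (i : ℕ) (hi : i + 1 < 2 * m) : i ∈ S ∨ i + 1 ∈ S := by
  apply h.2
  rw [cycleWithPendant, SimpleGraph.fromRel_adj]
  refine ⟨by omega, Or.inl (Or.inl ⟨by omega, ?_⟩)⟩
  rw [Nat.mod_eq_of_lt hi]

theorem cwp_pendant (m : ℕ) (hm : 2 ≤ m) (S : Finset ℕ) (h : IsCycleWithPendantCover m S) :
    2 * m ∈ S ∨ 0 ∈ S := by
  apply h.2
  rw [cycleWithPendant, SimpleGraph.fromRel_adj]
  exact ⟨by omega, Or.inl (Or.inr ⟨rfl, rfl⟩)⟩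

theorem cwp_subset (m : ℕ) (hm : 2 ≤ m) (S : Finset ℕ) (h : IsCycleWithPendantCover m S) :
    Finset.range m ⊆ S.image (fun i => i / 2) := by
  intro i hi
  rw [Finset.mem_range] at hi
  rw [Finset.mem_image]
  rcases cwp_edge m hm S h (2 * i) (by omega) with h1 | h1
  · exact ⟨_, h1, by omega⟩
  · exact ⟨_, h1, by omega⟩

/-- Every vertex cover of the even cycle of length `2m` with a pendant vertex
attached at `0` has at least `m` vertices, and the unique vertex cover with
exactly `m` vertices is `{0, 2, 4, …, 2m-2}`, the set of cycle vertices at even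
distance from the attachment vertex `0`. -/
theorem cycleWithPendant_min_vertex_cover (m : ℕ) (hm : 2 ≤ m) :
    (∀ S : Finset ℕ, IsCycleWithPendantCover m S → m ≤ S.card) ∧
    (∀ S : Finset ℕ, IsCycleWithPendantCover m S → S.card = m →
      S = (Finset.range m).image (fun i => 2 * i)) := by
  have key : ∀ S : Finset ℕ, IsCycleWithPendantCover m S → m ≤ S.card := by
    intro S h
    have h1 := Finset.card_le_card (cwp_subset m hm S h)
    rw [Finset.card_range] at h1
    exact h1.trans Finset.card_image_le
  refine ⟨key, ?_⟩
  intro S h hc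
  have hsub := cwp_subset m hm S h
  have hle : (S.image (fun i => i / 2)).card ≤ S.card := Finset.card_image_le
  have heq := Finset.eq_of_subset_of_card_le hsub (by rw [Finset.card_range]; omega)
  have hinj : Set.InjOn (fun i => i / 2) (S : Set ℕ) := by
    rw [← Finset.card_image_iff, ← heq, Finset.card_range, hc]
  have hlt : ∀ x ∈ S, x / 2 < m := by
    intro x hx
    rw [← Finset.mem_range, heq]
    exact Finset.mem_image_of_mem _ hx
  have hodd : ∀ i, 2 * i ∈ S → 2 * i + 1 ∉ S := by
    intro i h1 h2
    have := hinj (Finset.mem_coe.2 h1) (Finset.mem_coe.2 h2) (by simp only; omega)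
    omega
  have heven : ∀ i, i < m → 2 * i ∈ S := by
    intro i
    induction i with
    | zero =>
      intro _
      rcases cwp_pendant m hm S h with h1 | h1
      · have := hlt _ h1
        omega
      · exact h1
    | succ k ih =>
      intro hk
      rcases cwp_edge m hm S h (2 * k + 1) (by omega) with h1 | h1
      · exact absurd h1 (hodd k (ih (by omega)))
      · exact h1
  ext x
  simp only [Finset.mem_image, Finset.mem_range]
  constructor
  · intro hx
    refine ⟨x / 2, hlt x hx, ?_⟩
    by_contra hne
    have hx' : x = 2 * (x / 2) + 1 := by omega
    exact hodd (x / 2) (heven _ (hlt x hx)) (hx' ▸ hx)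
  · rintro ⟨i, hi, rfl⟩
    exact heven i hi
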